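/- arXiv:2210.06880 — 2 statements merged into one kernel-verified Lean document; each statement's English description precedes it below -/
import Mathlib

section
/- The number of pairs (γ, (τ₁, τ₂, τ₃, τ₄)) where γ ∈ S₃ is an involution (γ² = id) and τ₁,…,τ₄ are transpositions in S₃ satisfying: (1) τ₄∘τ₃∘τ₂∘τ₁ = id; (2) ⟨τ₁,…,τ₄⟩ acts transitively on {1,2,3}; (3) γ ∘ (τᵢ∘⋯∘τ₁) ∘ γ = (τᵢ∘⋯∘τ₁)⁻¹ for i = 1, 2, 3, and (γ∘τ₃∘τ₂∘τ₁) ∘ (τ₄∘τ₃∘τ₂∘τ₁) ∘ (γ∘τ₃∘τ₂∘τ₁) = (τ₄∘τ₃∘τ₂∘τ₁)⁻¹; (4) writing τᵢ = (aᵢ,bᵢ) with aᵢ < bᵢ, b₁ ≤ b₂ ≤ b₃ ≤ b₄; is exactly 6. -/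
open Equiv

def swc : Fin 3 → Equiv.Perm (Fin 3) := ![swap 0 1, swap 0 2, swap 1 2]
def loc : Fin 3 → Fin 3 := ![0, 0, 1]
def hic : Fin 3 → Fin 3 := ![1, 2, 2]
def fxc : Fin 3 → Fin 3 := ![2, 1, 0]

def codes : Finset (Equiv.Perm (Fin 3) × Fin 3 × Fin 3 × Fin 3 × Fin 3) :=
  {(1, 1, 1, 2, 2), (1, 2, 2, 1, 1), (1, 0, 0, 1, 1), (1, 0, 0, 2, 2),
   (swap 0 2, 1, 2, 2, 1), (swap 1 2, 2, 1, 1, 2)}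

def dec (q : Equiv.Perm (Fin 3) × Fin 3 × Fin 3 × Fin 3 × Fin 3) :
    Equiv.Perm (Fin 3) × (Fin 4 → Equiv.Perm (Fin 3)) :=
  (q.1, ![swc q.2.1, swc q.2.2.1, swc q.2.2.2.1, swc q.2.2.2.2])

lemma code_exists : ∀ a b : Fin 3, a < b → ∃ c, swap a b = swc c ∧ hic c = b := by decide

lemma swc_inj : ∀ c d : Fin 3, swc c = swc d → c = d := by decide

set_option maxRecDepth 100000 in
set_option synthInstance.maxHeartbeats 400000 in
set_option synthInstance.maxSize 2000 in
set_option maxSynthPendingDepth 20 in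
lemma prod_key : ∀ c0 c1 c2 c3 : Fin 3, hic c0 ≤ hic c1 → hic c1 ≤ hic c2 → hic c2 ≤ hic c3 →
    swc c3 * swc c2 * swc c1 * swc c0 = 1 → ∀ g : Equiv.Perm (Fin 3),
    g * swc c0 * g = (swc c0)⁻¹ →
    g * (swc c1 * swc c0) * g = (swc c1 * swc c0)⁻¹ →
    g * (swc c2 * swc c1 * swc c0) * g = (swc c2 * swc c1 * swc c0)⁻¹ →
    g * g = 1 →
    (c0 = c1 ∧ c0 = c2 ∧ c0 = c3) ∨ (g, c0, c1, c2, c3) ∈ codes := by decide +kernel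

lemma fix : ∀ c : Fin 3, swc c (fxc c) = fxc c := by decide

lemma trans_key : ∀ c d : Fin 3, c ≠ d → ∀ x y : Fin 3,
    (1 : Equiv.Perm (Fin 3)) x = y ∨ swc c x = y ∨ swc d x = y ∨
      (swc c * swc d) x = y ∨ (swc d * swc c) x = y := by decide

lemma swc_transitive (t : Fin 4 → Equiv.Perm (Fin 3)) (i j : Fin 4) (c d : Fin 3) (hcd : c ≠ d)
    (hi : t i = swc c) (hj : t j = swc d) (x y : Fin 3) :
    ∃ g ∈ Subgroup.closure (Set.range t), g x = y := by
  have h1 : swc c ∈ Subgroup.closure (Set.range t) := Subgroup.subset_closure ⟨i, hi⟩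
  have h2 : swc d ∈ Subgroup.closure (Set.range t) := Subgroup.subset_closure ⟨j, hj⟩
  rcases trans_key c d hcd x y with h | h | h | h | h
  · exact ⟨_, one_mem _, h⟩
  · exact ⟨_, h1, h⟩
  · exact ⟨_, h2, h⟩
  · exact ⟨_, mul_mem h1 h2, h⟩
  · exact ⟨_, mul_mem h2 h1, h⟩

lemma not_trans (t : Fin 4 → Equiv.Perm (Fin 3)) (c : Fin 3) (h : ∀ i, t i = swc c)
    (H : ∀ x y : Fin 3, ∃ g ∈ Subgroup.closure (Set.range t), g x = y) : False := by
  have hle : Subgroup.closure (Set.range t) ≤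
      MulAction.stabilizer (Equiv.Perm (Fin 3)) (fxc c) := by
    rw [Subgroup.closure_le]
    rintro _ ⟨i, rfl⟩
    rw [h i]
    exact fix c
  obtain ⟨g, hg, hx⟩ := H (fxc c) (fxc c + 1)
  have h2 : g (fxc c) = fxc c := hle hg
  rw [h2] at hx
  revert hx
  generalize fxc c = z
  revert z
  decide

lemma sw_lohi : ∀ c, loc c < hic c ∧ swc c = swap (loc c) (hic c) := by decide

set_option maxRecDepth 100000 in
lemma back_key : ∀ q ∈ codes,
    (q.2.1 ≠ q.2.2.2.1 ∨ q.2.1 ≠ q.2.2.1) ∧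
    hic q.2.1 ≤ hic q.2.2.1 ∧ hic q.2.2.1 ≤ hic q.2.2.2.1 ∧ hic q.2.2.2.1 ≤ hic q.2.2.2.2 ∧
    swc q.2.2.2.2 * swc q.2.2.2.1 * swc q.2.2.1 * swc q.2.1 = 1 ∧
    q.1 * q.1 = 1 ∧
    q.1 * swc q.2.1 * q.1 = (swc q.2.1)⁻¹ ∧
    q.1 * (swc q.2.2.1 * swc q.2.1) * q.1 = (swc q.2.2.1 * swc q.2.1)⁻¹ ∧
    q.1 * (swc q.2.2.2.1 * swc q.2.2.1 * swc q.2.1) * q.1 =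
      (swc q.2.2.2.1 * swc q.2.2.1 * swc q.2.1)⁻¹ ∧
    (q.1 * (swc q.2.2.2.1 * swc q.2.2.1 * swc q.2.1)) *
      (swc q.2.2.2.2 * swc q.2.2.2.1 * swc q.2.2.1 * swc q.2.1) *
      (q.1 * (swc q.2.2.2.1 * swc q.2.2.1 * swc q.2.1)) =
      (swc q.2.2.2.2 * swc q.2.2.2.1 * swc q.2.2.1 * swc q.2.1)⁻¹ := by decide +kernel

lemma dec_inj : Function.Injective dec := by
  rintro ⟨g, a, b, c, d⟩ ⟨g', a', b', c', d'⟩ h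
  have h1 : g = g' := congrArg Prod.fst h
  have h2 := congrArg Prod.snd h
  have e0 := swc_inj a a' (congrFun h2 0)
  have e1 := swc_inj b b' (congrFun h2 1)
  have e2 := swc_inj c c' (congrFun h2 2)
  have e3 := swc_inj d d' (congrFun h2 3)
  subst h1 e0 e1 e2 e3
  rfl

theorem stmt_11 :
    Nat.card {p : Equiv.Perm (Fin 3) × (Fin 4 → Equiv.Perm (Fin 3)) //
      (∀ i, (p.2 i).IsSwap) ∧
      p.2 3 * p.2 2 * p.2 1 * p.2 0 = 1 ∧
      (∀ x y : Fin 3, ∃ g ∈ Subgroup.closure (Set.range p.2), g x = y) ∧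
      p.1 * p.1 = 1 ∧
      p.1 * p.2 0 * p.1 = (p.2 0)⁻¹ ∧
      p.1 * (p.2 1 * p.2 0) * p.1 = (p.2 1 * p.2 0)⁻¹ ∧
      p.1 * (p.2 2 * p.2 1 * p.2 0) * p.1 = (p.2 2 * p.2 1 * p.2 0)⁻¹ ∧
      (p.1 * (p.2 2 * p.2 1 * p.2 0)) * (p.2 3 * p.2 2 * p.2 1 * p.2 0) *
          (p.1 * (p.2 2 * p.2 1 * p.2 0)) = (p.2 3 * p.2 2 * p.2 1 * p.2 0)⁻¹ ∧
      (∃ a b : Fin 4 → Fin 3,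
        (∀ i, a i < b i ∧ p.2 i = Equiv.swap (a i) (b i)) ∧ Monotone b)} = 6 := by
  have hc : (codes.image dec).card = 6 := by
    rw [Finset.card_image_of_injective _ dec_inj]
    decide +kernel
  rw [← hc]
  apply Nat.subtype_card
  rintro ⟨g, t⟩
  rw [Finset.mem_image]
  constructor
  · rintro ⟨q, hq, he⟩
    obtain ⟨hne, m1, m2, m3, k1, k2, k3, k4, k5, k6⟩ := back_key q hq
    obtain ⟨g', a, b, c, d⟩ := q
    obtain ⟨rfl, rfl⟩ := Prod.mk.inj he
    refine ⟨?_, k1, ?_, k2, k3, k4, k5, k6, ![loc a, loc b, loc c, loc d],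
      ![hic a, hic b, hic c, hic d], ?_, ?_⟩
    · have hs : ∀ c, (swc c).IsSwap := fun c =>
        ⟨loc c, hic c, (sw_lohi c).1.ne, (sw_lohi c).2⟩
      intro i
      fin_cases i
      exacts [hs a, hs b, hs c, hs d]
    · rcases hne with hne | hne
      · exact swc_transitive _ 0 2 a c hne rfl rfl
      · exact swc_transitive _ 0 1 a b hne rfl rfl
    · intro i
      fin_cases i
      exacts [sw_lohi a, sw_lohi b, sw_lohi c, sw_lohi d]
    · rw [Fin.monotone_iff_le_succ]
      intro i
      fin_cases i
      exacts [m1, m2, m3]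
  · rintro ⟨-, k1, H, k2, k3, k4, k5, -, a, b, hab, hm⟩
    choose c hc1 hc2 using fun i => code_exists (a i) (b i) (hab i).1
    have ht : ∀ i, t i = swc (c i) := fun i => (hab i).2.trans (hc1 i)
    have hmc : ∀ i j, i ≤ j → hic (c i) ≤ hic (c j) := by
      intro i j hij
      rw [hc2, hc2]
      exact hm hij
    simp only [ht] at k1 k3 k4 k5
    rcases prod_key (c 0) (c 1) (c 2) (c 3) (hmc _ _ (by decide)) (hmc _ _ (by decide))
      (hmc _ _ (by decide)) k1 g k3 k4 k5 k2 with ⟨e1, e2, e3⟩ | h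
    · refine (not_trans t (c 0) ?_ H).elim
      intro i
      rw [ht]
      fin_cases i
      · rfl
      · exact congrArg swc e1.symm
      · exact congrArg swc e2.symm
      · exact congrArg swc e3.symm
    · refine ⟨_, h, ?_⟩
      refine Prod.ext rfl ?_
      funext i
      rw [show (g, t).2 i = swc (c i) from ht i]
      fin_cases i <;> rfl
end

section
/- The number of tuples (γ, σ₁, τ₁, τ₂, σ₂) in the symmetric group S₄ satisfying: (1) σ₂ ∘ τ₂ ∘ τ₁ ∘ σ₁ = id; (2) σ₁ has cycle type (3,1) and σ₂ has cycle type (2,2); (3) τ₁, τ₂ are transpositions; (4) the subgroup generated by σ₁, σ₂, τ₁, τ₂ acts transitively on {1,2,3,4}; (5) γ² = id, γ ∘ σ₁ ∘ γ = σ₁⁻¹, γ ∘ (τ₁∘σ₁) ∘ γ = (τ₁∘σ₁)⁻¹ and γ ∘ (τ₂∘τ₁∘σ₁) ∘ γ = (τ₂∘τ₁∘σ₁)⁻¹; is exactly 24. -/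
open Equiv

lemma aux_three : ∀ σ : Perm (Fin 4), σ.cycleType = {3} ↔ (σ ≠ 1 ∧ σ * σ * σ = 1) := by
  decide +kernel

lemma aux_two : ∀ σ : Perm (Fin 4), σ.cycleType = {2, 2} ↔ (σ * σ = 1 ∧ ∀ x, σ x ≠ x) := by
  decide +kernel

def auxT : Finset (Perm (Fin 4)) := {swap 0 1, swap 0 2, swap 0 3, swap 1 2, swap 1 3, swap 2 3}

lemma aux_swap : ∀ σ : Perm (Fin 4), σ.IsSwap ↔ σ ∈ auxT := by
  unfold Perm.IsSwap
  decide +kernel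

lemma aux_trans : ∀ σ ρ : Perm (Fin 4), (σ ≠ 1 ∧ σ * σ * σ = 1) → (ρ * ρ = 1 ∧ ∀ x, ρ x ≠ x) →
    ∀ x y, ∃ i j k : Fin 3, (σ ^ (i : ℕ) * ρ ^ (j : ℕ) * σ ^ (k : ℕ)) x = y := by
  decide +kernel

def auxC : Finset (Perm (Fin 4)) :=
  {swap 0 1 * swap 1 2, swap 1 2 * swap 0 1, swap 0 1 * swap 1 3, swap 1 3 * swap 0 1,
   swap 0 2 * swap 2 3, swap 2 3 * swap 0 2, swap 1 2 * swap 2 3, swap 2 3 * swap 1 2}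

lemma aux_C : ∀ σ : Perm (Fin 4), σ ∈ auxC ↔ (σ ≠ 1 ∧ σ * σ * σ = 1) := by
  decide +kernel

def auxI : Finset (Perm (Fin 4)) :=
  {1, swap 0 1, swap 0 2, swap 0 3, swap 1 2, swap 1 3, swap 2 3,
   swap 0 1 * swap 2 3, swap 0 2 * swap 1 3, swap 0 3 * swap 1 2}

lemma aux_I : ∀ σ : Perm (Fin 4), σ ∈ auxI ↔ σ * σ = 1 := by
  decide +kernel

def auxA : Finset (Perm (Fin 4) × Perm (Fin 4)) :=
  (auxI ×ˢ auxC).filter fun p => p.1 * p.2 * p.1 = p.2⁻¹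

def auxF : Finset ((Perm (Fin 4) × Perm (Fin 4)) × Perm (Fin 4) × Perm (Fin 4)) :=
  (auxA ×ˢ auxT ×ˢ auxT).filter fun q =>
    q.1.1 * (q.2.1 * q.1.2) * q.1.1 = (q.2.1 * q.1.2)⁻¹ ∧
    q.1.1 * (q.2.2 * q.2.1 * q.1.2) * q.1.1 = (q.2.2 * q.2.1 * q.1.2)⁻¹ ∧
    ((q.2.2 * q.2.1 * q.1.2)⁻¹ * (q.2.2 * q.2.1 * q.1.2)⁻¹ = 1 ∧
      ∀ x, (q.2.2 * q.2.1 * q.1.2)⁻¹ x ≠ x)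

lemma auxF_card : auxF.card = 24 := by
  decide +kernel

theorem stmt_12 :
    Nat.card {p : Equiv.Perm (Fin 4) × Equiv.Perm (Fin 4) × Equiv.Perm (Fin 4) ×
        Equiv.Perm (Fin 4) × Equiv.Perm (Fin 4) //
      let γ := p.1; let σ₁ := p.2.1; let τ₁ := p.2.2.1; let τ₂ := p.2.2.2.1;
      let σ₂ := p.2.2.2.2;
      σ₂ * τ₂ * τ₁ * σ₁ = 1 ∧
      σ₁.cycleType = {3} ∧ σ₂.cycleType = {2, 2} ∧
      τ₁.IsSwap ∧ τ₂.IsSwap ∧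
      (∀ x y : Fin 4, ∃ g ∈ Subgroup.closure {σ₁, σ₂, τ₁, τ₂}, g x = y) ∧
      γ * γ = 1 ∧ γ * σ₁ * γ = σ₁⁻¹ ∧
      γ * (τ₁ * σ₁) * γ = (τ₁ * σ₁)⁻¹ ∧
      γ * (τ₂ * τ₁ * σ₁) * γ = (τ₂ * τ₁ * σ₁)⁻¹} = 24 := by
  classical
  let f : ((Perm (Fin 4) × Perm (Fin 4)) × Perm (Fin 4) × Perm (Fin 4)) →
      Perm (Fin 4) × Perm (Fin 4) × Perm (Fin 4) × Perm (Fin 4) × Perm (Fin 4) :=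
    fun q => (q.1.1, q.1.2, q.2.1, q.2.2, (q.2.2 * q.2.1 * q.1.2)⁻¹)
  have hf : Function.Injective f := by
    rintro ⟨⟨a, b⟩, c, d⟩ ⟨⟨a', b'⟩, c', d'⟩ h
    simp only [f, Prod.mk.injEq] at h ⊢
    tauto
  rw [← auxF_card, ← Finset.card_image_of_injective auxF hf]
  apply Nat.subtype_card
  rintro ⟨γ, σ₁, τ₁, τ₂, σ₂⟩
  simp only [Finset.mem_image, f, auxF, auxA, aux_C, aux_I, Finset.mem_filter, Finset.mem_product,
    Finset.mem_univ, true_and, Prod.mk.injEq, aux_three, aux_two, aux_swap]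
  constructor
  · rintro ⟨⟨⟨a, b⟩, c, d⟩, ⟨⟨⟨⟨h1, h2⟩, h3⟩, h4, h5⟩, h6, h7, h8⟩, rfl, rfl, rfl, rfl, rfl⟩
    refine ⟨by group, h2, h8, h4, h5, ?_, h1, h3, h6, h7⟩
    intro x y
    obtain ⟨i, j, k, h⟩ := aux_trans _ _ h2 h8 x y
    refine ⟨_, ?_, h⟩
    have hb := Subgroup.subset_closure (G := Perm (Fin 4))
      (k := {b, (d * c * b)⁻¹, c, d}) (show b ∈ _ by simp)
    have hc := Subgroup.subset_closure (G := Perm (Fin 4))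
      (k := {b, (d * c * b)⁻¹, c, d}) (show (d * c * b)⁻¹ ∈ _ from Or.inr (Or.inl rfl))
    exact mul_mem (mul_mem (pow_mem hb _) (pow_mem hc _)) (pow_mem hb _)
  · rintro ⟨h0, h2, h8, h4, h5, -, h1, h3, h6, h7⟩
    have e : σ₂ = (τ₂ * τ₁ * σ₁)⁻¹ := by
      apply eq_inv_of_mul_eq_one_left
      simpa only [mul_assoc] using h0
    subst e
    exact ⟨((γ, σ₁), τ₁, τ₂), ⟨⟨⟨⟨h1, h2⟩, h3⟩, h4, h5⟩, h6, h7, h8⟩, rfl, rfl, rfl, rfl, rfl⟩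
end
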